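/- arXiv:2406.09932 — 2 statements merged into one kernel-verified Lean document; each statement's English description precedes it below -/
import Mathlib

section
/- Let K be a real symmetric positive definite n×n matrix, λ > 0, y ∈ ℝⁿ, and let e : Fin m → Fin n be injective with K_CC := K∘(e,e), K_XC := K∘(id,e), K_CX := (K_XC)ᵀ. The function h : ℝᵐ → ℝ defined by h(β) := ‖y − K_XC β‖² + λ·βᵀ K_CC β has a unique global minimizer, namely β* = (K_CX K_XC + λ K_CC)⁻¹ K_CX y. -/
open Matrix

noncomputable section

/-- The `n × m` matrix `K_XC` of kernel evaluations between all points and control points. -/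
def KXC {n m : ℕ} (K : Matrix (Fin n) (Fin n) ℝ) (e : Fin m → Fin n) :
    Matrix (Fin n) (Fin m) ℝ :=
  K.submatrix id e

/-- The `m × m` control-point kernel matrix `K_CC`. -/
def KCC {n m : ℕ} (K : Matrix (Fin n) (Fin n) ℝ) (e : Fin m → Fin n) :
    Matrix (Fin m) (Fin m) ℝ :=
  K.submatrix e e

/-- The `m × n` matrix `K_CX = (K_XC)ᵀ`. -/
def KCX {n m : ℕ} (K : Matrix (Fin n) (Fin n) ℝ) (e : Fin m → Fin n) :
    Matrix (Fin m) (Fin n) ℝ :=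
  (KXC K e)ᵀ

end

/-- A solution of the normal equations strictly minimizes the generalized ridge objective
`β ↦ ‖y - A β‖² + βᵀ B β` when the penalty matrix `B` is positive definite. -/
theorem ridge_objective_lt_of_normal_eq {ι κ : Type*} [Fintype ι] [Fintype κ]
    (A : Matrix ι κ ℝ) {B : Matrix κ κ ℝ} (hB : B.PosDef) (y : ι → ℝ) {b β : κ → ℝ}
    (hb : (Aᵀ * A + B) *ᵥ b = Aᵀ *ᵥ y) (hne : β ≠ b) :
    (y - A *ᵥ b) ⬝ᵥ (y - A *ᵥ b) + b ⬝ᵥ (B *ᵥ b) <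
      (y - A *ᵥ β) ⬝ᵥ (y - A *ᵥ β) + β ⬝ᵥ (B *ᵥ β) := by
  obtain ⟨d, rfl⟩ : ∃ d, β = b + d := ⟨β - b, by simp⟩
  have hd : d ≠ 0 := by simpa using hne
  have hpos : 0 < d ⬝ᵥ (B *ᵥ d) := by simpa using hB.dotProduct_mulVec_pos hd
  have hnonneg : 0 ≤ (A *ᵥ d) ⬝ᵥ (A *ᵥ d) := by
    simpa using dotProduct_star_self_nonneg (A *ᵥ d)
  have hBt : Bᵀ = B := by simpa using hB.isHermitian.eq
  have hsymm : b ⬝ᵥ (B *ᵥ d) = d ⬝ᵥ (B *ᵥ b) := by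
    rw [dotProduct_mulVec, ← mulVec_transpose, hBt, dotProduct_comm]
  have hadj (v : ι → ℝ) : d ⬝ᵥ (Aᵀ *ᵥ v) = (A *ᵥ d) ⬝ᵥ v := by
    rw [dotProduct_mulVec, vecMul_transpose]
  have hcross : (A *ᵥ d) ⬝ᵥ (A *ᵥ b) + d ⬝ᵥ (B *ᵥ b) = (A *ᵥ d) ⬝ᵥ y := by
    rw [← hadj, ← hadj, ← hb, add_mulVec, ← mulVec_mulVec, dotProduct_add]
  simp only [mulVec_add, dotProduct_add, add_dotProduct, dotProduct_sub, sub_dotProduct, hsymm]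
  rw [dotProduct_comm y (A *ᵥ d), dotProduct_comm (A *ᵥ b) (A *ᵥ d)]
  linarith

/-- For a real symmetric positive definite matrix `K`, `λ > 0`, `y ∈ ℝⁿ`
and injective control indices `e`, the Nyström kernel ridge regression objective
`h(β) = ‖y − K_XC β‖² + λ·βᵀ K_CC β` has a unique global minimizer,
namely `β* = (K_CX K_XC + λ K_CC)⁻¹ K_CX y`. -/
theorem nystrom_krr_unique_minimizer {n m : ℕ}
    (K : Matrix (Fin n) (Fin n) ℝ) (hK : K.PosDef)
    (lam : ℝ) (hlam : 0 < lam) (y : Fin n → ℝ)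
    (e : Fin m → Fin n) (he : Function.Injective e) :
    let h : (Fin m → ℝ) → ℝ :=
      fun β => (y - KXC K e *ᵥ β) ⬝ᵥ (y - KXC K e *ᵥ β) + lam * (β ⬝ᵥ (KCC K e *ᵥ β))
    let βstar := (KCX K e * KXC K e + lam • KCC K e)⁻¹ *ᵥ (KCX K e *ᵥ y)
    ∀ β : Fin m → ℝ, β ≠ βstar → h βstar < h β := by
  intro h βstar β hne
  have hB : (lam • KCC K e).PosDef := (hK.submatrix he).smul hlam
  have hH : ((KXC K e)ᵀ * KXC K e + lam • KCC K e).PosDef :=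
    PosDef.posSemidef_add (posSemidef_conjTranspose_mul_self (KXC K e)) hB
  have hb : ((KXC K e)ᵀ * KXC K e + lam • KCC K e) *ᵥ βstar = (KXC K e)ᵀ *ᵥ y := by
    simp only [βstar, KCX]
    rw [mulVec_mulVec, mul_nonsing_inv _ ((isUnit_iff_isUnit_det _).mp hH.isUnit), one_mulVec]
  simpa [h, smul_mulVec, dotProduct_smul] using
    ridge_objective_lt_of_normal_eq (KXC K e) hB y hb hne
end

section
/- Let K be a real symmetric positive definite n×n matrix, 1 ≤ m < n, and let A be a real n×d matrix. For each subset S ⊆ {1,…,n} with |S| = m, let K_S be the principal submatrix of K on S and Q_S := K_{XS} K_S⁻¹ K_{SX} the corresponding Nyström approximation. Let λ₁ ≥ … ≥ λₙ be the eigenvalues of K in decreasing order. Then Σ_{S : |S|=m} det(K_S) · tr(Aᵀ (K − Q_S) A) ≤ ‖A‖_F² · (m+1) · (Σ_{i=m+1}^{n} λᵢ) · Σ_{S : |S|=m} det(K_S). -/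
open Matrix

noncomputable section

/-- The principal submatrix `K_S` of `K` on the index set `S`. -/
def principalSub {n : ℕ} (K : Matrix (Fin n) (Fin n) ℝ) (S : Finset (Fin n)) :
    Matrix ↥S ↥S ℝ :=
  K.submatrix (fun i : ↥S => (i : Fin n)) (fun i : ↥S => (i : Fin n))

/-- The Nyström approximation `Q_S = K_{XS} ⬝ K_S⁻¹ ⬝ K_{SX}` of `K` based on the
control-index set `S`. -/
def nystromS {n : ℕ} (K : Matrix (Fin n) (Fin n) ℝ) (S : Finset (Fin n)) :
    Matrix (Fin n) (Fin n) ℝ :=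
  K.submatrix id (fun i : ↥S => (i : Fin n)) * (principalSub K S)⁻¹ *
    (K.submatrix id (fun i : ↥S => (i : Fin n)))ᵀ

end

/-- Removing a marked point gives a correspondence between pairs `i ∉ S` with `#S = m` and pairs
`i ∈ T` with `#T = m + 1`. -/
theorem Finset.sum_powersetCard_sum_compl {ι M : Type*} [Fintype ι] [DecidableEq ι]
    [AddCommMonoid M] (m : ℕ) (f : ι → Finset ι → M) :
    ∑ S ∈ powersetCard m univ, ∑ i ∈ Sᶜ, f i S =
      ∑ T ∈ powersetCard (m + 1) univ, ∑ i ∈ T, f i (T.erase i) := by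
  rw [Finset.sum_sigma', Finset.sum_sigma']
  refine Finset.sum_bij' (fun p _ => ⟨insert p.2 p.1, p.2⟩) (fun p _ => ⟨p.1.erase p.2, p.2⟩)
    ?_ ?_ ?_ ?_ ?_
  all_goals
    rintro ⟨S, i⟩ h
    simp only [mem_sigma, mem_powersetCard, subset_univ, true_and, mem_compl] at h ⊢
  · simp [card_insert_of_notMem h.2, h.1]
  · simp [card_erase_of_mem h.2, h.1]
  · simp [erase_insert h.2]
  · simp [insert_erase h.2]
  · simp [erase_insert h.2]

/-- The ratio of consecutive elementary symmetric functions of nonnegative numbers is at most the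
sum of all but the first `m` of them. -/
theorem Finset.sum_powersetCard_succ_prod_le {n : ℕ} (m : ℕ) (x : Fin n → ℝ) (hx : ∀ i, 0 ≤ x i) :
    ∑ T ∈ powersetCard (m + 1) univ, ∏ i ∈ T, x i ≤
      (∑ i ∈ univ.filter (fun i : Fin n => m ≤ (i : ℕ)), x i) *
        ∑ S ∈ powersetCard m univ, ∏ i ∈ S, x i := by
  have hg (i : Fin n) (S : Finset (Fin n)) :
      0 ≤ (if m ≤ i.val then x i else 0) * ∏ k ∈ S, x k :=
    mul_nonneg (by split_ifs <;> simp [hx]) (prod_nonneg fun k _ => hx k)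
  calc ∑ T ∈ powersetCard (m + 1) univ, ∏ i ∈ T, x i
      ≤ ∑ T ∈ powersetCard (m + 1) univ, ∑ i ∈ T,
          (if m ≤ i.val then x i else 0) * ∏ k ∈ T.erase i, x k := by
        refine sum_le_sum fun T hT => ?_
        obtain ⟨i, hi, him⟩ : ∃ i ∈ T, m ≤ (i : ℕ) := by
          by_contra! h
          have hle : T.card ≤ (range m).card := card_le_card_of_injOn (fun i : Fin n => (i : ℕ))
            (fun i hi => by simpa using h i hi) Fin.val_injective.injOn
          rw [card_range, (mem_powersetCard.mp hT).2] at hle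
          omega
        refine le_trans (le_of_eq ?_) (single_le_sum (fun j _ => hg j (T.erase j)) hi)
        simp only [if_pos him, mul_prod_erase T x hi]
    _ = ∑ S ∈ powersetCard m univ, ∑ i ∈ Sᶜ,
          (if m ≤ i.val then x i else 0) * ∏ k ∈ S, x k :=
        (sum_powersetCard_sum_compl m fun i S =>
          (if m ≤ i.val then x i else 0) * ∏ k ∈ S, x k).symm
    _ ≤ ∑ S ∈ powersetCard m univ, ∑ i : Fin n,
          (if m ≤ i.val then x i else 0) * ∏ k ∈ S, x k :=
        sum_le_sum fun S _ => sum_le_sum_of_subset_of_nonneg (subset_univ _) fun i _ _ => hg i S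
    _ = _ := by
        rw [mul_sum]
        exact sum_congr rfl fun S _ => by rw [← sum_mul, sum_filter]

/-- A sum of principal minors of a Hermitian matrix is an elementary symmetric function of its
eigenvalues. -/
theorem Matrix.IsHermitian.sum_det_submatrix_eq_sum_prod_eigenvalues {ι : Type*} [Fintype ι]
    [DecidableEq ι] {K : Matrix ι ι ℝ} (hK : K.IsHermitian) {k : ℕ} (hk : k ≤ Fintype.card ι) :
    ∑ S ∈ Finset.powersetCard k (Finset.univ : Finset ι),
        (K.submatrix (Subtype.val : S → ι) (Subtype.val : S → ι)).det =
      ∑ S ∈ Finset.powersetCard k Finset.univ, ∏ i ∈ S, hK.eigenvalues i := by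
  have hminors := K.charpoly_coeff_eq_sum_minors k hk
  have hprod : K.charpoly = ((Finset.univ.val.map hK.eigenvalues).map
      fun t => Polynomial.X - Polynomial.C t).prod := by
    rw [hK.charpoly_eq, Multiset.map_map]
    rfl
  have hcard : Multiset.card (Finset.univ.val.map hK.eigenvalues) = Fintype.card ι := by
    simp [Finset.card_univ]
  rw [hprod, Multiset.prod_X_sub_C_coeff _ (by omega), hcard, Nat.sub_sub_self hk,
    Finset.esymm_map_val] at hminors
  exact (mul_left_cancel₀ (pow_ne_zero k (by norm_num)) hminors).symm

theorem Matrix.trace_transpose_mul_self {ι κ : Type*} [Fintype ι] [Fintype κ]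
    (C : Matrix ι κ ℝ) : (Cᵀ * C).trace = ∑ j, ∑ i, C i j ^ 2 := by
  simp [trace, mul_apply, sq]

/-- The quadratic form of a positive semidefinite matrix is bounded by its trace times the squared
Frobenius norm. -/
theorem Matrix.PosSemidef.trace_transpose_mul_mul_le {ι κ : Type*} [Fintype ι] [Fintype κ]
    {R : Matrix ι ι ℝ} (hR : R.PosSemidef) (A : Matrix ι κ ℝ) :
    (Aᵀ * R * A).trace ≤ (∑ i, ∑ j, A i j ^ 2) * R.trace := by
  classical
  open scoped MatrixOrder in
  obtain ⟨B, rfl⟩ := CStarAlgebra.nonneg_iff_eq_star_mul_self.mp hR.nonneg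
  have hB : star B = Bᵀ := by
    rw [star_eq_conjTranspose, conjTranspose_eq_transpose_of_trivial]
  have hsplit : Aᵀ * (Bᵀ * B) * A = (B * A)ᵀ * (B * A) := by
    simp only [transpose_mul, Matrix.mul_assoc]
  rw [hB, hsplit, trace_transpose_mul_self, trace_transpose_mul_self, Finset.sum_comm (f := fun i j => A i j ^ 2), Finset.sum_mul]
  refine Finset.sum_le_sum fun j _ => ?_
  rw [Finset.sum_comm (f := fun i k => B k i ^ 2), Finset.mul_sum]
  refine Finset.sum_le_sum fun k _ => ?_
  rw [mul_apply, mul_comm]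
  exact Finset.sum_mul_sq_le_sq_mul_sq _ _ _

theorem posDef_principalSub {n : ℕ} {K : Matrix (Fin n) (Fin n) ℝ} (hK : K.PosDef)
    (S : Finset (Fin n)) : (principalSub K S).PosDef :=
  hK.submatrix Subtype.val_injective

theorem posSemidef_sub_nystromS {n : ℕ} {K : Matrix (Fin n) (Fin n) ℝ} (hK : K.PosDef)
    (S : Finset (Fin n)) : (K - nystromS K S).PosSemidef := by
  have hS := posDef_principalSub hK S
  have := hS.isUnit.invertible
  have hT : K.submatrix id (fun i : ↥S => (i : Fin n)) =
      (K.submatrix (fun i : ↥S => (i : Fin n)) id)ᴴ := by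
    rw [conjTranspose_submatrix, hK.1.eq]
  have hblocks : fromBlocks (principalSub K S) (K.submatrix (fun i : ↥S => (i : Fin n)) id)
      (K.submatrix id fun i : ↥S => (i : Fin n)) K =
        K.submatrix (Sum.elim (fun i : ↥S => (i : Fin n)) id)
          (Sum.elim (fun i : ↥S => (i : Fin n)) id) := by
    ext (i | i) (j | j) <;> rfl
  have hschur := (Matrix.PosDef.fromBlocks₁₁
    (K.submatrix (fun i : ↥S => (i : Fin n)) id) K hS).mp (by
      rw [← hT, hblocks]
      exact hK.posSemidef.submatrix _)
  rwa [nystromS, hT, ← conjTranspose_eq_transpose_of_trivial, conjTranspose_conjTranspose]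

theorem det_principalSub_mul_sub_nystromS_apply {n : ℕ} {K : Matrix (Fin n) (Fin n) ℝ}
    (hK : K.PosDef) (S : Finset (Fin n)) (i : Fin n) :
    (principalSub K S).det * (K - nystromS K S) i i =
      (K.submatrix (Sum.elim (fun j : ↥S => (j : Fin n)) fun _ : Unit => i)
        (Sum.elim (fun j : ↥S => (j : Fin n)) fun _ : Unit => i)).det := by
  have := (posDef_principalSub hK S).isUnit.invertible
  have hblocks : K.submatrix (Sum.elim (fun j : ↥S => (j : Fin n)) fun _ : Unit => i)
        (Sum.elim (fun j : ↥S => (j : Fin n)) fun _ : Unit => i) =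
      fromBlocks (principalSub K S) (K.submatrix (fun j : ↥S => (j : Fin n)) fun _ => i)
        (K.submatrix (fun _ => i) fun j : ↥S => (j : Fin n))
        (K.submatrix (fun _ => i) fun _ => i) := by
    ext (i | i) (j | j) <;> rfl
  have hsymm (a b : Fin n) : K a b = K b a := by simpa using hK.1.apply b a
  rw [hblocks, det_fromBlocks₁₁, invOf_eq_nonsing_inv, det_unique (n := Unit)]
  congr 1
  simp [nystromS, mul_apply, hsymm i]

theorem det_principalSub_mul_sub_nystromS_apply_of_mem {n : ℕ} {K : Matrix (Fin n) (Fin n) ℝ}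
    (hK : K.PosDef) {S : Finset (Fin n)} {i : Fin n} (hi : i ∈ S) :
    (principalSub K S).det * (K - nystromS K S) i i = 0 := by
  rw [det_principalSub_mul_sub_nystromS_apply hK]
  exact det_zero_of_row_eq (i := Sum.inl ⟨i, hi⟩) (j := Sum.inr ()) (by simp) rfl

theorem det_principalSub_mul_sub_nystromS_apply_of_notMem {n : ℕ} {K : Matrix (Fin n) (Fin n) ℝ}
    (hK : K.PosDef) {S : Finset (Fin n)} {i : Fin n} (hi : i ∉ S) :
    (principalSub K S).det * (K - nystromS K S) i i = (principalSub K (insert i S)).det := by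
  rw [det_principalSub_mul_sub_nystromS_apply hK]
  let e : ↥S ⊕ Unit ≃ ↥(insert i S) := (Equiv.optionEquivSumPUnit _).symm.trans
    (Finset.subtypeInsertEquivOption hi).symm
  rw [← det_submatrix_equiv_self e, principalSub, submatrix_submatrix]
  have he : (fun j : ↥(insert i S) => (j : Fin n)) ∘ e =
      Sum.elim (fun j : ↥S => (j : Fin n)) fun _ : Unit => i := by
    ext (j | j) <;> rfl
  rw [he]

/-- The total trace error of the Nyström approximations, weighted by determinants, is `m + 1` times
the sum of the principal minors of size `m + 1`. -/
theorem sum_det_principalSub_mul_trace_sub_nystromS {n : ℕ} {K : Matrix (Fin n) (Fin n) ℝ}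
    (hK : K.PosDef) (m : ℕ) :
    ∑ S ∈ Finset.powersetCard m (Finset.univ : Finset (Fin n)),
        (principalSub K S).det * (K - nystromS K S).trace =
      ((m : ℝ) + 1) * ∑ T ∈ Finset.powersetCard (m + 1) (Finset.univ : Finset (Fin n)),
        (principalSub K T).det := by
  calc _ = ∑ S ∈ Finset.powersetCard m (Finset.univ : Finset (Fin n)), ∑ i ∈ Sᶜ,
          (principalSub K (insert i S)).det := by
        refine Finset.sum_congr rfl fun S _ => ?_
        rw [trace, Finset.mul_sum, ← Finset.sum_add_sum_compl S]
        simp only [diag_apply]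
        rw [Finset.sum_eq_zero fun i hi =>
          det_principalSub_mul_sub_nystromS_apply_of_mem hK hi, zero_add]
        exact Finset.sum_congr rfl fun i hi =>
          det_principalSub_mul_sub_nystromS_apply_of_notMem hK (Finset.mem_compl.mp hi)
    _ = ∑ T ∈ Finset.powersetCard (m + 1) (Finset.univ : Finset (Fin n)), ∑ i ∈ T,
          (principalSub K (insert i (T.erase i))).det :=
        Finset.sum_powersetCard_sum_compl m fun i S => (principalSub K (insert i S)).det
    _ = _ := by
        rw [Finset.mul_sum]
        refine Finset.sum_congr rfl fun T hT => ?_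
        rw [Finset.sum_congr rfl fun i hi => by rw [Finset.insert_erase hi], Finset.sum_const,
          (Finset.mem_powersetCard.mp hT).2, nsmul_eq_mul]
        push_cast
        rfl

/-- (m-DPP part of Theorem 5.1, unnormalized, in matrix form.) Let `K`
be real symmetric positive definite, `1 ≤ m < n`, `A` a real `n × d` weight matrix, and
let `λ₁ ≥ … ≥ λₙ` be the eigenvalues of `K` in decreasing order. Then
`∑_{|S|=m} det(K_S) tr(Aᵀ(K − Q_S)A)
  ≤ ‖A‖_F² (m+1) (∑_{i=m+1}^n λᵢ) ∑_{|S|=m} det(K_S)`. -/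
theorem dpp_compression_error_bound {n m d : ℕ} (hm : 1 ≤ m) (hmn : m < n)
    (K : Matrix (Fin n) (Fin n) ℝ) (hK : K.PosDef)
    (A : Matrix (Fin n) (Fin d) ℝ)
    (lam : Fin n → ℝ)
    (hsorted : ∀ i j : Fin n, i ≤ j → lam j ≤ lam i)
    (heig : ∃ σ : Equiv.Perm (Fin n), ∀ i, lam i = hK.1.eigenvalues (σ i)) :
    ∑ S ∈ Finset.powersetCard m (Finset.univ : Finset (Fin n)),
        (principalSub K S).det * (Aᵀ * (K - nystromS K S) * A).trace
      ≤ (∑ i : Fin n, ∑ j : Fin d, (A i j) ^ 2) * ((m : ℝ) + 1) *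
          (∑ i ∈ Finset.univ.filter (fun i : Fin n => m ≤ (i : ℕ)), lam i) *
          ∑ S ∈ Finset.powersetCard m (Finset.univ : Finset (Fin n)),
            (principalSub K S).det := by
  obtain ⟨σ, hσ⟩ := heig
  have hminors {k : ℕ} (hk : k ≤ n) :
      ∑ S ∈ Finset.powersetCard k (Finset.univ : Finset (Fin n)), (principalSub K S).det =
        ∑ S ∈ Finset.powersetCard k Finset.univ, ∏ i ∈ S, lam i := by
    have hmap : Finset.univ.val.map lam = Finset.univ.val.map hK.1.eigenvalues := by
      rw [funext hσ]
      conv_rhs => rw [← Multiset.map_univ_val_equiv σ, Multiset.map_map]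
      rfl
    rw [← Finset.esymm_map_val, hmap, Finset.esymm_map_val]
    exact hK.1.sum_det_submatrix_eq_sum_prod_eigenvalues (by simpa using hk)
  have hlam (i : Fin n) : 0 ≤ lam i := hσ i ▸ (hK.eigenvalues_pos _).le
  calc _ ≤ ∑ S ∈ Finset.powersetCard m (Finset.univ : Finset (Fin n)),
          (∑ i : Fin n, ∑ j : Fin d, A i j ^ 2) *
            ((principalSub K S).det * (K - nystromS K S).trace) := by
        refine Finset.sum_le_sum fun S _ => ?_
        rw [mul_left_comm]
        exact mul_le_mul_of_nonneg_left
          ((posSemidef_sub_nystromS hK S).trace_transpose_mul_mul_le A)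
          (posDef_principalSub hK S).det_pos.le
    _ = (∑ i : Fin n, ∑ j : Fin d, A i j ^ 2) * ((m : ℝ) + 1) *
          ∑ T ∈ Finset.powersetCard (m + 1) Finset.univ, ∏ i ∈ T, lam i := by
        rw [← Finset.mul_sum, sum_det_principalSub_mul_trace_sub_nystromS hK, hminors hmn,
          mul_assoc]
    _ ≤ _ := by
        rw [hminors hmn.le, mul_assoc _ (Finset.sum _ _) (Finset.sum _ _)]
        exact mul_le_mul_of_nonneg_left (Finset.sum_powersetCard_succ_prod_le m lam hlam)
          (by positivity)
end
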